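/- Let (v_n) be a positive sequence in GS(v*), let (γ_n) ⊂ (0,1) be a positive sequence in GS(−α) with α ∈ (1/2,1] such that ξ := lim_{n→∞} (nγ_n)^{−1} exists, and let l > 0 satisfy l − v*·ξ > 0. Then, with Π_n = ∏_{j=1}^n (1−γ_j), one has lim_{n→∞} v_n Π_n^l Σ_{k=1}^n Π_k^{−l} (γ_k / v_k) = 1/(l − v*·ξ). -/

import Mathlib

open MeasureTheory Filter Finset Real

noncomputable section

/-- Bernstein basis polynomial `b_k(m,x) = C(m,k) x^k (1-x)^(m-k)`. -/
def bern (m k : ℕ) (x : ℝ) : ℝ := (m.choose k : ℝ) * x ^ k * (1 - x) ^ (m - k)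

/-- `T_{n,m}(x)` built from the observation `t = X_n`:
`T_{n,m}(x) = m ∑_{k=0}^{m-1} 1{k/m < X_n ≤ (k+1)/m} b_k(m-1,x)`. -/
def Tstat (m : ℕ) (t x : ℝ) : ℝ :=
  (m : ℝ) * ∑ k ∈ Finset.range m,
    (if (k : ℝ) / (m : ℝ) < t ∧ t ≤ ((k : ℝ) + 1) / (m : ℝ) then (1 : ℝ) else 0)
      * bern (m - 1) k x

/-- `Z_n(x) = 2 T_{n,m_n}(x) - T_{n,m_n/2}(x)`. -/
def Zstat (m : ℕ) (t x : ℝ) : ℝ := 2 * Tstat m t x - Tstat (m / 2) t x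

/-- `Π_n = ∏_{j=1}^n (1 - γ_j)`. -/
def Pprod (γ : ℕ → ℝ) (n : ℕ) : ℝ := ∏ j ∈ Finset.Icc 1 n, (1 - γ j)

/-- The recursive estimator `f_n(x) = Π_n ∑_{k=1}^n Π_k⁻¹ γ_k Z_k(x)`, evaluated at the
sample point `ω`. -/
def fhat {Ω : Type*} (X : ℕ → Ω → ℝ) (γ : ℕ → ℝ) (m : ℕ → ℕ) (x : ℝ) (n : ℕ) (ω : Ω) : ℝ :=
  Pprod γ n * ∑ k ∈ Finset.Icc 1 n, (Pprod γ k)⁻¹ * γ k * Zstat (m k) (X k ω) x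

/-- A positive sequence `(v_n)` belongs to `GS(c)`:
`lim_{n→∞} n (1 - v_{n-1}/v_n) = c`. -/
def IsGS (v : ℕ → ℝ) (c : ℝ) : Prop :=
  (∀ n, 0 < v n) ∧ Tendsto (fun n : ℕ => (n : ℝ) * (1 - v (n - 1) / v n)) atTop (nhds c)

/-- `Δ₂(x)`, with derivatives of `f` taken within `[0,1]`. -/
def Δ₂ (f : ℝ → ℝ) (x : ℝ) : ℝ :=
  (1 / 6) * (1 - 6 * x * (1 - x)) * iteratedDerivWithin 2 f (Set.Icc 0 1) x
    + (5 / 12) * x * (1 - x) * (1 - 2 * x) * iteratedDerivWithin 3 f (Set.Icc 0 1) x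
    + (1 / 8) * x ^ 2 * (1 - x) ^ 2 * iteratedDerivWithin 4 f (Set.Icc 0 1) x

/-- `ψ(x) = (4πx(1-x))^{-1/2}`. -/
def ψfun (x : ℝ) : ℝ := (4 * π * x * (1 - x)) ^ (-(1 : ℝ) / 2)

/-- `C₃ = 1/√2 + 4(1 - √(2/3))`. -/
def C₃ : ℝ := 1 / Real.sqrt 2 + 4 * (1 - Real.sqrt (2 / 3))

/-- `C₁ = ∫₀¹ f(x) ψ(x) dx`. -/
def C₁ (f : ℝ → ℝ) : ℝ := ∫ x in (0 : ℝ)..1, f x * ψfun x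

/-- `C₂ = ∫₀¹ Δ₂(x)² dx`. -/
def C₂ (f : ℝ → ℝ) : ℝ := ∫ x in (0 : ℝ)..1, (Δ₂ f x) ^ 2

/-- If `x (n + 1) ≤ (1 - g n) * x n` with `0 ≤ g n ≤ 1` and `∑ g n = ∞`, then `x` is
eventually below every positive number. -/
lemma eventually_lt_of_le_one_sub_mul {x g : ℕ → ℝ} (hg0 : ∀ n, 0 ≤ g n) (hg1 : ∀ n, g n ≤ 1)
    (hgs : ¬ Summable g) (hx : ∀ n, x (n + 1) ≤ (1 - g n) * x n) {δ : ℝ} (hδ : 0 < δ) :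
    ∀ᶠ n in atTop, x n < δ := by
  have hbound : ∀ n, x n ≤ Real.exp (-∑ i ∈ Finset.range n, g i) * |x 0| := by
    intro n
    induction n with
    | zero => simpa using le_abs_self (x 0)
    | succ n ih =>
      calc x (n + 1) ≤ (1 - g n) * x n := hx n
        _ ≤ (1 - g n) * (Real.exp (-∑ i ∈ Finset.range n, g i) * |x 0|) :=
          mul_le_mul_of_nonneg_left ih (sub_nonneg.2 (hg1 n))
        _ ≤ Real.exp (-g n) * (Real.exp (-∑ i ∈ Finset.range n, g i) * |x 0|) :=
          mul_le_mul_of_nonneg_right (Real.one_sub_le_exp_neg _) (by positivity)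
        _ = Real.exp (-∑ i ∈ Finset.range (n + 1), g i) * |x 0| := by
          rw [Finset.sum_range_succ, neg_add, Real.exp_add]
          ring
  have hsum := (not_summable_iff_tendsto_nat_atTop_of_nonneg hg0).1 hgs
  have hlim : Tendsto (fun n => Real.exp (-∑ i ∈ Finset.range n, g i) * |x 0|) atTop (nhds 0) := by
    simpa using (Real.tendsto_exp_neg_atTop_nhds_zero.comp hsum).mul_const |x 0|
  filter_upwards [hlim.eventually_lt_const hδ] with n hn
  exact (hbound n).trans_lt hn

/-- A perturbed linear recursion with step sizes `g` tending to zero, `∑ g n = ∞`, and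
asymptotically positive drift tends to zero when the perturbation does. -/
lemma tendsto_zero_of_perturbed_recursion {w g c e : ℕ → ℝ} {C : ℝ} (hC : 0 < C)
    (hg0 : ∀ n, 0 ≤ g n) (hg : Tendsto g atTop (nhds 0)) (hgs : ¬ Summable g)
    (hc : Tendsto c atTop (nhds C)) (he : Tendsto e atTop (nhds 0))
    (hw : ∀ n, w (n + 1) = (1 - g n * c n) * w n + g n * e n) :
    Tendsto w atTop (nhds 0) := by
  rw [Metric.tendsto_nhds]
  intro ε hε
  have hgc : Tendsto (fun n => g n * c n) atTop (nhds 0) := by simpa using hg.mul hc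
  have hgC : Tendsto (fun n => g n * (C / 2)) atTop (nhds 0) := by
    simpa using hg.mul_const (C / 2)
  have hea : Tendsto (fun n => |e n|) atTop (nhds 0) := by simpa using he.abs
  have hev := (hgc.eventually_lt_const one_pos).and <| (hgC.eventually_lt_const one_pos).and <|
    (hc.eventually_const_lt (half_lt_self hC)).and <|
    hea.eventually_lt_const (show 0 < C / 2 * (ε / 2) by positivity)
  obtain ⟨N, hN⟩ := eventually_atTop.1 hev
  have hstep : ∀ n, |w (n + 1 + N)| - ε / 2 ≤ (1 - g (n + N) * (C / 2)) * (|w (n + N)| - ε / 2) := by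
    intro n
    obtain ⟨h1, -, h3, h4⟩ := hN (n + N) (Nat.le_add_left _ _)
    have hle : |w (n + 1 + N)| ≤
        (1 - g (n + N) * c (n + N)) * |w (n + N)| + g (n + N) * |e (n + N)| := by
      rw [add_right_comm, hw]
      refine (abs_add_le _ _).trans_eq ?_
      rw [abs_mul, abs_mul, abs_of_nonneg (hg0 _), abs_of_pos (sub_pos.2 h1)]
    have hdrift : g (n + N) * (C / 2) * |w (n + N)| ≤ g (n + N) * c (n + N) * |w (n + N)| :=
      mul_le_mul_of_nonneg_right (mul_le_mul_of_nonneg_left h3.le (hg0 _)) (abs_nonneg _)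
    have hpert := mul_le_mul_of_nonneg_left h4.le (hg0 (n + N))
    linarith
  have hns : ¬ Summable fun n => g (n + N) * (C / 2) := by
    rw [summable_mul_right_iff (by positivity), summable_nat_add_iff]
    exact hgs
  have hfin := eventually_lt_of_le_one_sub_mul (x := fun n => |w (n + N)| - ε / 2)
    (fun n => mul_nonneg (hg0 (n + N)) (half_pos hC).le)
    (fun n => (hN (n + N) (Nat.le_add_left _ _)).2.1.le) hns hstep (half_pos hε)
  obtain ⟨M, hM⟩ := eventually_atTop.1 hfin
  refine eventually_atTop.2 ⟨M + N, fun n hn => ?_⟩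
  have h := hM (n - N) (by omega)
  simp only [Nat.sub_add_cancel (show N ≤ n by omega)] at h
  rw [Real.dist_eq, sub_zero]
  linarith

namespace IsGS

variable {v : ℕ → ℝ} {a : ℝ}

lemma tendsto_ratio (hv : IsGS v a) :
    Tendsto (fun n => v (n + 1) / v n) atTop (nhds 1) := by
  have h : Tendsto (fun n : ℕ => 1 - ((n : ℝ) * (1 - v (n - 1) / v n)) * (n : ℝ)⁻¹)
      atTop (nhds 1) := by
    simpa using (hv.2.mul tendsto_inv_atTop_nhds_zero_nat).const_sub 1
  have h' := (h.comp (tendsto_add_atTop_nat 1)).inv₀ one_ne_zero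
  rw [inv_one] at h'
  refine h'.congr fun n => ?_
  have hn : ((n + 1 : ℕ) : ℝ) ≠ 0 := Nat.cast_ne_zero.2 n.succ_ne_zero
  simp only [Function.comp_apply, Nat.add_sub_cancel]
  rw [mul_right_comm, mul_inv_cancel₀ hn, one_mul, sub_sub_cancel, inv_div]

lemma tendsto_mul_ratio_sub_one (hv : IsGS v a) :
    Tendsto (fun n : ℕ => ((n : ℝ) + 1) * (v (n + 1) / v n - 1)) atTop (nhds a) := by
  have h := (hv.2.comp (tendsto_add_atTop_nat 1)).mul hv.tendsto_ratio
  rw [mul_one] at h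
  refine h.congr fun n => ?_
  have := (hv.1 n).ne'
  have := (hv.1 (n + 1)).ne'
  simp only [Function.comp_apply, Nat.add_sub_cancel, Nat.cast_add, Nat.cast_one]
  field_simp

lemma tendsto_zero (hv : IsGS v a) (ha : a < 0) : Tendsto v atTop (nhds 0) := by
  refine tendsto_zero_of_perturbed_recursion (g := fun n : ℕ => 1 / ((n : ℝ) + 1)) (e := 0)
    (neg_pos.2 ha) (fun n => by positivity) tendsto_one_div_add_atTop_nhds_zero_nat ?_
    hv.tendsto_mul_ratio_sub_one.neg tendsto_const_nhds fun n => ?_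
  · have := Real.not_summable_one_div_natCast
    rw [← summable_nat_add_iff 1] at this
    simpa using this
  · have := (hv.1 n).ne'
    simp only [Pi.zero_apply]
    field_simp
    ring

end IsGS

lemma tendsto_one_sub_one_sub_rpow_div {g : ℕ → ℝ} (hg : Tendsto g atTop (nhds 0))
    (hg0 : ∀ n, g n ≠ 0) (l : ℝ) :
    Tendsto (fun n => (1 - (1 - g n) ^ l) / g n) atTop (nhds l) := by
  have hd : HasDerivAt (fun x : ℝ => (1 - x) ^ l) (-l) 0 := by
    simpa using ((hasDerivAt_id (0 : ℝ)).const_sub 1).rpow_const (p := l) (by simp)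
  have h := (hd.tendsto_slope_zero.comp
    (tendsto_nhdsWithin_iff.2 ⟨hg, Eventually.of_forall hg0⟩)).neg
  rw [neg_neg] at h
  refine h.congr fun n => ?_
  simp only [Function.comp_apply, zero_add, sub_zero, Real.one_rpow, smul_eq_mul]
  field_simp
  ring

lemma not_summable_of_tendsto_inv_mul {g : ℕ → ℝ} {ξ : ℝ} (hg : ∀ n, 0 < g n)
    (hξ : Tendsto (fun n : ℕ => ((n : ℝ) * g n)⁻¹) atTop (nhds ξ)) : ¬ Summable g := by
  intro hs
  refine Real.not_summable_one_div_natCast ?_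
  refine summable_of_isBigO_nat hs ?_
  have h : (fun n : ℕ => ((n : ℝ) * g n)⁻¹ * g n) =O[atTop] fun n => 1 * g n :=
    (hξ.isBigO_one ℝ).mul (Asymptotics.isBigO_refl _ _)
  simp only [one_mul] at h
  refine h.congr_left fun n => ?_
  have := (hg n).ne'
  rw [mul_inv, mul_assoc, inv_mul_cancel₀ this, mul_one, one_div]

lemma Pprod_succ (γ : ℕ → ℝ) (n : ℕ) : Pprod γ (n + 1) = Pprod γ n * (1 - γ (n + 1)) :=
  Finset.prod_Icc_succ_top (by omega) _

lemma Pprod_pos {γ : ℕ → ℝ} (hγ : ∀ n, γ n < 1) (n : ℕ) : 0 < Pprod γ n :=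
  Finset.prod_pos fun j _ => sub_pos.2 (hγ j)

lemma weighted_sum_succ {v γ : ℕ → ℝ} (hv : ∀ n, 0 < v n) (hγ : ∀ n, γ n < 1) (l : ℝ) (n : ℕ) :
    v (n + 1) * Pprod γ (n + 1) ^ l *
        ∑ k ∈ Finset.Icc 1 (n + 1), Pprod γ k ^ (-l) * (γ k / v k) =
      v (n + 1) / v n * (1 - γ (n + 1)) ^ l *
        (v n * Pprod γ n ^ l * ∑ k ∈ Finset.Icc 1 n, Pprod γ k ^ (-l) * (γ k / v k)) +
      γ (n + 1) := by
  have hP := Pprod_pos hγ (n + 1)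
  have hv0 := (hv n).ne'
  have hv1 := (hv (n + 1)).ne'
  have hcancel : Pprod γ (n + 1) ^ l * Pprod γ (n + 1) ^ (-l) = 1 := by
    rw [← Real.rpow_add hP, add_neg_cancel, Real.rpow_zero]
  have hsucc : Pprod γ (n + 1) ^ l = Pprod γ n ^ l * (1 - γ (n + 1)) ^ l := by
    rw [Pprod_succ, Real.mul_rpow (Pprod_pos hγ n).le (sub_nonneg.2 (hγ _).le)]
  have hlast : v (n + 1) * Pprod γ (n + 1) ^ l *
      (Pprod γ (n + 1) ^ (-l) * (γ (n + 1) / v (n + 1))) = γ (n + 1) := by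
    calc _ = (Pprod γ (n + 1) ^ l * Pprod γ (n + 1) ^ (-l)) *
          (v (n + 1) * (γ (n + 1) / v (n + 1))) := by ring
      _ = γ (n + 1) := by rw [hcancel, one_mul, mul_div_cancel₀ _ hv1]
  rw [Finset.sum_Icc_succ_top (by omega), mul_add, hlast, hsucc]
  field_simp

/-- Mokkadem–Pelletier technical lemma, first part: if `(v_n) ∈ GS(v*)`,
`(γ_n) ⊂ (0,1)` is in `GS(-α)` with `α ∈ (1/2,1]`, `ξ = lim (nγ_n)⁻¹` exists,
and `l > 0` with `l - v*·ξ > 0`, then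
`lim_n v_n Π_n^l ∑_{k=1}^n Π_k^{-l} (γ_k / v_k) = 1/(l - v*·ξ)`. -/
theorem technical_lemma_part1 (v γ : ℕ → ℝ) (vstar α ξ l : ℝ)
    (hv : IsGS v vstar)
    (hγ01 : ∀ n, γ n ∈ Set.Ioo (0 : ℝ) 1)
    (hγ : IsGS γ (-α)) (hα : α ∈ Set.Ioc (1 / 2 : ℝ) 1)
    (hξ : Tendsto (fun n : ℕ => ((n : ℝ) * γ n)⁻¹) atTop (nhds ξ))
    (hl : 0 < l) (hlv : l - vstar * ξ > 0) :
    Tendsto (fun n : ℕ =>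
        v n * (Pprod γ n) ^ l * ∑ k ∈ Finset.Icc 1 n, (Pprod γ k) ^ (-l) * (γ k / v k))
      atTop (nhds (1 / (l - vstar * ξ))) := by
  have hγ0 : ∀ n, 0 < γ n := fun n => (hγ01 n).1
  have hγ1 : ∀ n, γ n < 1 := fun n => (hγ01 n).2
  have hγne : ∀ n, γ n ≠ 0 := fun n => (hγ0 n).ne'
  have hγlim : Tendsto (fun n => γ (n + 1)) atTop (nhds 0) :=
    (hγ.tendsto_zero (by linarith [hα.1])).comp (tendsto_add_atTop_nat 1)
  have hpow := tendsto_one_sub_one_sub_rpow_div hγlim (fun n => hγne _) l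
  have hdrift : Tendsto
      (fun n => (1 - v (n + 1) / v n * (1 - γ (n + 1)) ^ l) / γ (n + 1)) atTop
      (nhds (l - vstar * ξ)) := by
    have h := (hv.tendsto_ratio.mul hpow).sub
      (hv.tendsto_mul_ratio_sub_one.mul (hξ.comp (tendsto_add_atTop_nat 1)))
    rw [one_mul] at h
    refine h.congr fun n => ?_
    have := hγne (n + 1)
    have := (hv.1 n).ne'
    have : (n : ℝ) + 1 ≠ 0 := by positivity
    simp only [Function.comp_apply, Nat.cast_add, Nat.cast_one]
    field_simp
    ring
  rw [← tendsto_sub_nhds_zero_iff]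
  refine tendsto_zero_of_perturbed_recursion hlv (fun n => (hγ0 (n + 1)).le) hγlim ?_ hdrift
    (e := fun n => 1 - (1 - v (n + 1) / v n * (1 - γ (n + 1)) ^ l) / γ (n + 1) /
      (l - vstar * ξ)) ?_ fun n => ?_
  · rw [summable_nat_add_iff 1]
    exact not_summable_of_tendsto_inv_mul hγ0 hξ
  · simpa [div_self hlv.ne'] using (hdrift.div_const (l - vstar * ξ)).const_sub 1
  · rw [weighted_sum_succ hv.1 hγ1]
    have := hγne (n + 1)
    have := hlv.ne'
    generalize v (n + 1) / v n * (1 - γ (n + 1)) ^ l = A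
    field_simp
    ring
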